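/- arXiv:2303.03353 — 5 statements merged into one kernel-verified Lean document; each statement's English description precedes it below -/
import Mathlib

section
/- Let A and B be finite nonempty types and let p be a bipartite conditional probability distribution with binary setting sets X = Y = Fin 2 and outcome sets A, B. Then the following are equivalent: (i) p admits a local hidden variable (LHV) model; (ii) there exists a function q : (Fin 2 → A) × (Fin 2 → B) → ℝ with q(f,g) ≥ 0 for all (f,g) and Σ_{f,g} q(f,g) = 1, such that for all x, y ∈ Fin 2, a ∈ A, b ∈ B: p x y a b = Σ over all pairs (f,g) with f x = a and g y = b of q(f,g). (Fine's theorem, bipartite case with two binary settings.) -/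
open scoped BigOperators

/-- The marginal at coordinate `x` of a product of normalized weights is the weight at `x`. -/
theorem sum_filter_prod_eq {X A : Type*} [Fintype X] [DecidableEq X] [Fintype A] [DecidableEq A]
    (w : X → A → ℝ) (hw : ∀ x, ∑ a, w x a = 1) (x : X) (a : A) :
    ∑ f : X → A with f x = a, ∏ i, w i (f i) = w x a := by
  have hset : Finset.univ.filter (fun f : X → A => f x = a) =
      Fintype.piFinset (Function.update (fun _ => Finset.univ) x ({a} : Finset A)) := by
    ext f
    simp only [Finset.mem_filter, Finset.mem_univ, true_and, Fintype.mem_piFinset]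
    refine ⟨fun h i => ?_, fun h => by simpa using h x⟩
    by_cases hi : i = x
    · subst hi; simpa using h
    · simp [hi]
  rw [hset, ← Finset.prod_univ_sum, Finset.prod_eq_single x]
  · simp
  · intro i _ hi
    simpa [hi] using hw i
  · simp

/-- The total mass of a product of normalized weights is one. -/
theorem sum_prod_eq_one {X A : Type*} [Fintype X] [DecidableEq X] [Fintype A]
    (w : X → A → ℝ) (hw : ∀ x, ∑ a, w x a = 1) :
    ∑ f : X → A, ∏ i, w i (f i) = 1 := by
  classical
  rw [← Fintype.piFinset_univ, ← Finset.prod_univ_sum]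
  simp [hw]

/-- A product of normalized nonnegative weights is at most one. -/
theorem prod_le_one_of_sum_eq_one {X A : Type*} [Fintype X] [Fintype A]
    (w : X → A → ℝ) (h0 : ∀ x a, 0 ≤ w x a) (hw : ∀ x, ∑ a, w x a = 1) (f : X → A) :
    ∏ i, w i (f i) ≤ 1 :=
  Finset.prod_le_one (fun i _ => h0 i _) fun i _ =>
    (Finset.single_le_sum (fun a _ => h0 i a) (Finset.mem_univ (f i))).trans_eq (hw i)

theorem PMF.hasSum_toReal {Λ : Type*} (μ : PMF Λ) : HasSum (fun l => (μ l).toReal) 1 := by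
  have h := ENNReal.hasSum_toReal (f := μ) (by rw [μ.tsum_coe]; exact ENNReal.one_ne_top)
  rwa [← ENNReal.tsum_toReal_eq μ.apply_ne_top, μ.tsum_coe, ENNReal.toReal_one] at h

/-- Fine's theorem, bipartite case with two binary settings: a bipartite conditional
probability distribution admits a local hidden variable model iff there is a joint
distribution over pairs of deterministic response functions reproducing it. -/
theorem fine_bipartite {A B : Type} [Fintype A] [Nonempty A] [DecidableEq A]
    [Fintype B] [Nonempty B] [DecidableEq B]
    (p : Fin 2 → Fin 2 → A → B → ℝ)
    (hnn : ∀ x y a b, 0 ≤ p x y a b)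
    (hnorm : ∀ x y, ∑ a : A, ∑ b : B, p x y a b = 1) :
    (∃ (Λ : Type) (μ : PMF Λ) (α : Λ → Fin 2 → A → ℝ) (β : Λ → Fin 2 → B → ℝ),
      (∀ l x a, 0 ≤ α l x a) ∧ (∀ l x, ∑ a : A, α l x a = 1) ∧
      (∀ l y b, 0 ≤ β l y b) ∧ (∀ l y, ∑ b : B, β l y b = 1) ∧
      (∀ x y a b, p x y a b = ∑' l : Λ, (μ l).toReal * α l x a * β l y b)) ↔
    (∃ q : (Fin 2 → A) × (Fin 2 → B) → ℝ,
      (∀ fg, 0 ≤ q fg) ∧ (∑ fg : (Fin 2 → A) × (Fin 2 → B), q fg = 1) ∧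
      (∀ x y a b, p x y a b =
        ∑ fg ∈ Finset.univ.filter
          (fun fg : (Fin 2 → A) × (Fin 2 → B) => fg.1 x = a ∧ fg.2 y = b), q fg)) := by
  constructor
  · rintro ⟨Λ, μ, α, β, hα0, hα1, hβ0, hβ1, hp⟩
    let r : Λ → (Fin 2 → A) × (Fin 2 → B) → ℝ := fun l fg =>
      (μ l).toReal * ((∏ i, α l i (fg.1 i)) * ∏ i, β l i (fg.2 i))
    have hα (l) (f : Fin 2 → A) : 0 ≤ ∏ i, α l i (f i) := Finset.prod_nonneg fun i _ => hα0 l i _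
    have hβ (l) (g : Fin 2 → B) : 0 ≤ ∏ i, β l i (g i) := Finset.prod_nonneg fun i _ => hβ0 l i _
    have hr0 (l fg) : 0 ≤ r l fg :=
      mul_nonneg ENNReal.toReal_nonneg (mul_nonneg (hα l fg.1) (hβ l fg.2))
    have hr (fg) : Summable fun l => r l fg :=
      μ.hasSum_toReal.summable.of_nonneg_of_le (fun l => hr0 l fg) fun l =>
        mul_le_of_le_one_right ENNReal.toReal_nonneg <| mul_le_one₀
          (prod_le_one_of_sum_eq_one _ (hα0 l) (hα1 l) fg.1) (hβ l fg.2)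
          (prod_le_one_of_sum_eq_one _ (hβ0 l) (hβ1 l) fg.2)
    refine ⟨fun fg => ∑' l, r l fg, fun fg => tsum_nonneg fun l => hr0 l fg, ?_, ?_⟩
    · rw [← Summable.tsum_finsetSum fun fg _ => hr fg, ← μ.hasSum_toReal.tsum_eq]
      refine tsum_congr fun l => ?_
      rw [← Finset.mul_sum, ← Finset.univ_product_univ, Finset.sum_product]
      dsimp only
      rw [← Finset.sum_mul_sum, sum_prod_eq_one _ (hα1 l), sum_prod_eq_one _ (hβ1 l)]
      simp
    · intro x y a b
      rw [hp, ← Summable.tsum_finsetSum fun fg _ => hr fg]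
      refine tsum_congr fun l => ?_
      rw [← Finset.mul_sum, ← Finset.univ_product_univ,
        Finset.filter_product (fun f : Fin 2 → A => f x = a) (fun g : Fin 2 → B => g y = b),
        Finset.sum_product]
      dsimp only
      rw [← Finset.sum_mul_sum, sum_filter_prod_eq _ (hα1 l), sum_filter_prod_eq _ (hβ1 l),
        mul_assoc]
  · rintro ⟨q, hq0, hq1, hp⟩
    refine ⟨(Fin 2 → A) × (Fin 2 → B),
      PMF.ofFintype (fun fg => ENNReal.ofReal (q fg)) ?_,
      fun fg x a => if fg.1 x = a then 1 else 0, fun fg y b => if fg.2 y = b then 1 else 0,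
      ?_, ?_, ?_, ?_, ?_⟩
    · rw [← ENNReal.ofReal_sum_of_nonneg fun fg _ => hq0 fg, hq1, ENNReal.ofReal_one]
    · intro l x a
      positivity
    · simp
    · intro l y b
      positivity
    · simp
    · intro x y a b
      rw [hp, tsum_fintype, Finset.sum_filter]
      refine Finset.sum_congr rfl fun fg _ => ?_
      rw [PMF.ofFintype_apply, ENNReal.toReal_ofReal (hq0 fg), ite_and]
      split_ifs <;> simp_all
end

section
/- Let n ≥ 1, and for each i : Fin n let X i be a finite nonempty setting set and A i a finite nonempty outcome set. Let p : (Π i, X i) → (Π i, A i) → ℝ be an n-partite conditional probability distribution. Then the following are equivalent: (i) p admits an n-partite local hidden variable (LHV) model; (ii) there exists q : (Π i, X i → A i) → ℝ with q F ≥ 0 for all F and Σ_F q F = 1, such that for every setting tuple x and outcome tuple a: p x a = Σ over all F : (Π i, X i → A i) satisfying F i (x i) = a i for every i, of q F. (Fine's theorem, n-partite case.) -/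
open scoped BigOperators

/-- When rows are sampled independently from the stochastic matrix `β`, the response functions
sending `x` to `a` have total weight `β x a`. -/
theorem sum_filter_prod_eq_apply {X A : Type*} [Fintype X] [DecidableEq X] [Fintype A]
    [DecidableEq A] (β : X → A → ℝ) (hβ : ∀ x, ∑ a, β x a = 1) (x : X) (a : A) :
    ∑ f ∈ Finset.univ.filter (fun f : X → A => f x = a), ∏ y, β y (f y) = β x a := by
  have h : Finset.univ.filter (fun f : X → A => f x = a) =
      Fintype.piFinset fun y => if y = x then {a} else Finset.univ := by
    ext f
    simp only [Finset.mem_filter, Finset.mem_univ, true_and, Fintype.mem_piFinset]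
    constructor
    · intro hf y
      split_ifs with hy
      · subst hy
        simpa using hf
      · exact Finset.mem_univ _
    · intro hf
      simpa using hf x
  rw [h, ← Finset.prod_univ_sum, Finset.prod_eq_single x]
  · simp
  · intro y _ hy
    simp [hy, hβ]
  · simp

/-- The multipartite version of `sum_filter_prod_eq_apply`. -/
theorem sum_filter_prod_prod_eq_prod {ι : Type*} [Fintype ι] [DecidableEq ι] {X A : ι → Type*}
    [∀ i, Fintype (X i)] [∀ i, DecidableEq (X i)] [∀ i, Fintype (A i)] [∀ i, DecidableEq (A i)]
    (β : (i : ι) → X i → A i → ℝ) (hβ : ∀ i x, ∑ a, β i x a = 1)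
    (x : ∀ i, X i) (a : ∀ i, A i)
    [DecidablePred fun F : ∀ i, X i → A i => ∀ i, F i (x i) = a i] :
    ∑ F ∈ Finset.univ.filter (fun F : ∀ i, X i → A i => ∀ i, F i (x i) = a i),
      ∏ i, ∏ y, β i y (F i y) = ∏ i, β i (x i) (a i) := by
  have h : Finset.univ.filter (fun F : ∀ i, X i → A i => ∀ i, F i (x i) = a i) =
      Fintype.piFinset fun i => Finset.univ.filter (fun f : X i → A i => f (x i) = a i) := by
    ext F
    simp [Fintype.mem_piFinset]
  rw [h, ← Finset.prod_univ_sum (fun i => Finset.univ.filter fun f : X i → A i => f (x i) = a i)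
    (fun i f => ∏ y, β i y (f y))]
  exact Finset.prod_congr rfl fun i _ => sum_filter_prod_eq_apply (β i) (hβ i) (x i) (a i)

/-- A function with values in `[0, 1]` is summable against a probability mass function. -/
theorem PMF.summable_toReal_mul {Λ : Type*} (μ : PMF Λ) {f : Λ → ℝ} (h0 : ∀ l, 0 ≤ f l)
    (h1 : ∀ l, f l ≤ 1) : Summable fun l => (μ l).toReal * f l :=
  (ENNReal.summable_toReal μ.tsum_coe_ne_top).of_nonneg_of_le
    (fun l => mul_nonneg ENNReal.toReal_nonneg (h0 l))
    (fun l => mul_le_of_le_one_right ENNReal.toReal_nonneg (h1 l))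

/-- Fine's theorem, n-partite case: an n-partite conditional probability distribution
admits a local hidden variable model iff there is a joint distribution over tuples of
deterministic response functions reproducing it. -/
theorem fine_npartite {n : ℕ} (hn : 1 ≤ n)
    {X : Fin n → Type} {A : Fin n → Type}
    [∀ i, Fintype (X i)] [∀ i, Nonempty (X i)] [∀ i, DecidableEq (X i)]
    [∀ i, Fintype (A i)] [∀ i, Nonempty (A i)] [∀ i, DecidableEq (A i)]
    (p : (∀ i, X i) → (∀ i, A i) → ℝ)
    (hnn : ∀ x a, 0 ≤ p x a)
    (hnorm : ∀ x, ∑ a : ∀ i, A i, p x a = 1) :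
    (∃ (Λ : Type) (μ : PMF Λ) (α : (i : Fin n) → Λ → X i → A i → ℝ),
      (∀ i l x a, 0 ≤ α i l x a) ∧ (∀ i l x, ∑ a : A i, α i l x a = 1) ∧
      (∀ x a, p x a = ∑' l : Λ, (μ l).toReal * ∏ i, α i l (x i) (a i))) ↔
    (∃ q : (∀ i, X i → A i) → ℝ,
      (∀ F, 0 ≤ q F) ∧ (∑ F : ∀ i, X i → A i, q F = 1) ∧
      (∀ x a, p x a =
        ∑ F ∈ Finset.univ.filter
          (fun F : ∀ i, X i → A i => ∀ i, F i (x i) = a i), q F)) := by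
  constructor
  · rintro ⟨Λ, μ, α, hα0, hα1, hp⟩
    have hα_le : ∀ i l x a, α i l x a ≤ 1 := fun i l x a =>
      (Finset.single_le_sum (fun b _ => hα0 i l x b) (Finset.mem_univ a)).trans_eq (hα1 i l x)
    have hw0 : ∀ (F : ∀ i, X i → A i) l, 0 ≤ ∏ i, ∏ y, α i l y (F i y) := fun F l =>
      Finset.prod_nonneg fun i _ => Finset.prod_nonneg fun y _ => hα0 i l y _
    have hw1 : ∀ (F : ∀ i, X i → A i) l, ∏ i, ∏ y, α i l y (F i y) ≤ 1 := fun F l =>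
      Finset.prod_le_one (fun i _ => Finset.prod_nonneg fun y _ => hα0 i l y _) fun i _ =>
        Finset.prod_le_one (fun y _ => hα0 i l y _) fun y _ => hα_le i l y _
    have hq : ∀ x a, p x a =
        ∑ F ∈ Finset.univ.filter (fun F : ∀ i, X i → A i => ∀ i, F i (x i) = a i),
          ∑' l, (μ l).toReal * ∏ i, ∏ y, α i l y (F i y) := by
      intro x a
      rw [hp, ← Summable.tsum_finsetSum fun F _ => μ.summable_toReal_mul (hw0 F) (hw1 F)]
      refine tsum_congr fun l => ?_
      rw [← Finset.mul_sum,
        sum_filter_prod_prod_eq_prod (fun i => α i l) (fun i => hα1 i l)]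
    refine ⟨fun F => ∑' l, (μ l).toReal * ∏ i, ∏ y, α i l y (F i y),
      fun F => tsum_nonneg fun l => mul_nonneg ENNReal.toReal_nonneg (hw0 F l), ?_, hq⟩
    let x : ∀ i, X i := fun i => Classical.arbitrary (X i)
    rw [← hnorm x, ← Finset.sum_fiberwise Finset.univ
      (fun (F : ∀ i, X i → A i) i => F i (x i))]
    refine Finset.sum_congr rfl fun a _ => ?_
    rw [hq x a]
    simp only [funext_iff]
  · rintro ⟨q, hq0, hq1, hp⟩
    refine ⟨∀ i, X i → A i, PMF.ofFintype (fun F => ENNReal.ofReal (q F)) ?_,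
      fun i F x a => if F i x = a then 1 else 0, ?_, ?_, ?_⟩
    · rw [← ENNReal.ofReal_sum_of_nonneg fun F _ => hq0 F, hq1, ENNReal.ofReal_one]
    · intro i F x a
      dsimp only
      split_ifs <;> norm_num
    · simp
    · intro x a
      rw [hp, tsum_fintype, Finset.sum_filter]
      refine Finset.sum_congr rfl fun F _ => ?_
      rw [PMF.ofFintype_apply, ENNReal.toReal_ofReal (hq0 F), Finset.prod_ite_zero]
      simp
end

section
/- Let X, Y be finite setting sets and A, B finite outcome sets, and let p be a bipartite conditional probability distribution. Suppose there exist x₀ ∈ X, y₀ ∈ Y, a₀ ∈ A, b₀ ∈ B with p x₀ y₀ a₀ b₀ > 0, but there exist no functions f : X → A and g : Y → B with f x₀ = a₀ and g y₀ = b₀ such that p x y (f x) (g y) > 0 for all x, y. Then p does not admit a local hidden variable (LHV) model. (Possibilistic Bell nonlocality implies Bell nonlocality.) -/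
open scoped BigOperators

/-- A family of functions summing to one admits a choice of points where they are positive,
extending any given such point. -/
theorem exists_selector_pos {X A : Type*} [Fintype A] (q : X → A → ℝ)
    (hsum : ∀ x, ∑ a : A, q x a = 1) {x₀ : X} {a₀ : A} (h : 0 < q x₀ a₀) :
    ∃ f : X → A, f x₀ = a₀ ∧ ∀ x, 0 < q x (f x) := by
  have key : ∀ x, ∃ a, (x = x₀ → a = a₀) ∧ 0 < q x a := by
    intro x
    by_cases hx : x = x₀
    · exact ⟨a₀, fun _ => rfl, hx ▸ h⟩
    · obtain ⟨a, -, ha⟩ := Finset.exists_lt_of_sum_lt (s := Finset.univ)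
        (f := fun _ => (0 : ℝ)) (g := q x) (by simp [hsum x])
      exact ⟨a, fun hx' => absurd hx' hx, ha⟩
  choose f hf hfpos using key
  exact ⟨f, hf x₀ rfl, hfpos⟩

/-- A nonnegative function on a finite type that sums to one is bounded by one. -/
theorem le_one_of_sum_eq_one {A : Type*} [Fintype A] {q : A → ℝ} (hq : ∀ a, 0 ≤ q a)
    (hsum : ∑ a : A, q a = 1) (a : A) : q a ≤ 1 :=
  hsum ▸ Finset.single_le_sum (fun i _ => hq i) (Finset.mem_univ a)

/-- Weighting a probability mass function by two functions valued in the unit interval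
gives a summable family. -/
theorem PMF.summable_toReal_mul_mul {Λ : Type*} (μ : PMF Λ) {u v : Λ → ℝ}
    (hu : ∀ l, 0 ≤ u l) (hu' : ∀ l, u l ≤ 1) (hv : ∀ l, 0 ≤ v l) (hv' : ∀ l, v l ≤ 1) :
    Summable fun l => (μ l).toReal * u l * v l := by
  refine Summable.of_nonneg_of_le
    (fun l => mul_nonneg (mul_nonneg ENNReal.toReal_nonneg (hu l)) (hv l)) (fun l => ?_)
    (ENNReal.summable_toReal μ.tsum_coe_ne_top)
  exact (mul_le_of_le_one_right (mul_nonneg ENNReal.toReal_nonneg (hu l)) (hv' l)).trans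
    (mul_le_of_le_one_right ENNReal.toReal_nonneg (hu' l))

/-- Possibilistic Bell nonlocality implies Bell nonlocality: if some local assignment
has nonzero probability but cannot be extended to a global assignment of outcomes all
of whose local assignments are possible, then the distribution admits no local hidden
variable model. -/
theorem possibilistic_nonlocality_implies_no_LHV
    {X Y A B : Type} [Fintype X] [Fintype Y] [Fintype A] [Fintype B]
    (p : X → Y → A → B → ℝ)
    (hnn : ∀ x y a b, 0 ≤ p x y a b)
    (hnorm : ∀ x y, ∑ a : A, ∑ b : B, p x y a b = 1)
    (x₀ : X) (y₀ : Y) (a₀ : A) (b₀ : B)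
    (hpos : 0 < p x₀ y₀ a₀ b₀)
    (hnoext : ¬ ∃ (f : X → A) (g : Y → B), f x₀ = a₀ ∧ g y₀ = b₀ ∧
        ∀ x y, 0 < p x y (f x) (g y)) :
    ¬ (∃ (Λ : Type) (μ : PMF Λ) (α : Λ → X → A → ℝ) (β : Λ → Y → B → ℝ),
      (∀ l x a, 0 ≤ α l x a) ∧ (∀ l x, ∑ a : A, α l x a = 1) ∧
      (∀ l y b, 0 ≤ β l y b) ∧ (∀ l y, ∑ b : B, β l y b = 1) ∧
      (∀ x y a b, p x y a b = ∑' l : Λ, (μ l).toReal * α l x a * β l y b)) := by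
  rintro ⟨Λ, μ, α, β, hα, hαsum, hβ, hβsum, hp⟩
  have hterm : ∀ x y a b l, 0 ≤ (μ l).toReal * α l x a * β l y b := fun x y a b l =>
    mul_nonneg (mul_nonneg ENNReal.toReal_nonneg (hα l x a)) (hβ l y b)
  obtain ⟨l, hl⟩ : ∃ l, (μ l).toReal * α l x₀ a₀ * β l y₀ b₀ ≠ 0 := by
    by_contra! h
    rw [hp] at hpos
    simp [h] at hpos
  have hμl : 0 < (μ l).toReal :=
    ENNReal.toReal_nonneg.lt_of_ne' (left_ne_zero_of_mul (left_ne_zero_of_mul hl))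
  obtain ⟨f, hf, hfpos⟩ := exists_selector_pos (α l) (hαsum l)
    ((hα l x₀ a₀).lt_of_ne' (right_ne_zero_of_mul (left_ne_zero_of_mul hl)))
  obtain ⟨g, hg, hgpos⟩ := exists_selector_pos (β l) (hβsum l)
    ((hβ l y₀ b₀).lt_of_ne' (right_ne_zero_of_mul hl))
  refine hnoext ⟨f, g, hf, hg, fun x y => ?_⟩
  rw [hp]
  exact (μ.summable_toReal_mul_mul (fun l => hα l x (f x))
    (fun l => le_one_of_sum_eq_one (hα l x) (hαsum l x) (f x)) (fun l => hβ l y (g y))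
    (fun l => le_one_of_sum_eq_one (hβ l y) (hβsum l y) (g y))).tsum_pos
    (hterm x y (f x) (g y)) l (mul_pos (mul_pos hμl (hfpos x)) (hgpos y))
end

section
/- Let S, T, S', T' be countable types, let p be a probability mass function on S × T, and let f : S → PMF S' and g : T → PMF T' be Markov kernels. Then there exists a probability mass function q on S × T × S' × T' (namely q(s,t,s',t') = p(s,t) · f s s' · g t t') whose four pairwise marginals satisfy: (i) the marginal on (S,T) equals p; (ii) the marginal on (S',T) at (s',t) equals Σ_s p(s,t) · f s s'; (iii) the marginal on (S,T') at (s,t') equals Σ_t p(s,t) · g t t'; and (iv) the marginal on (S',T') at (s',t') equals Σ_{s,t} p(s,t) · f s s' · g t t'. (In a theory with collapses, the predictions for all four pairs of friend/superobserver measurements are marginals of a single joint distribution, so collapse theories are consistent with the absoluteness of observed events.) -/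
open scoped BigOperators ENNReal

/-- The joint distribution obtained by drawing `(s, t)` from `p` and then, independently,
`s'` from `f s` and `t'` from `g t`. -/
noncomputable def PMF.collapseJoint {S T S' T' : Type}
    (p : PMF (S × T)) (f : S → PMF S') (g : T → PMF T') : PMF (S × T × S' × T') :=
  ⟨fun x => p (x.1, x.2.1) * f x.1 x.2.2.1 * g x.2.1 x.2.2.2, by
    refine ENNReal.summable.hasSum_iff.mpr ?_
    simp only [ENNReal.tsum_prod', ENNReal.tsum_mul_left, PMF.tsum_coe, mul_one]
    rw [← ENNReal.tsum_prod (f := fun s t => p (s, t))]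
    exact p.tsum_coe⟩

theorem PMF.collapseJoint_apply {S T S' T' : Type}
    (p : PMF (S × T)) (f : S → PMF S') (g : T → PMF T') (s : S) (t : T) (s' : S') (t' : T') :
    p.collapseJoint f g (s, t, s', t') = p (s, t) * f s s' * g t t' :=
  rfl

/-- In a theory with collapses, the predictions for all four pairs of measurements
(initial pair, each mixed pair, and the pair of supermeasurements) are marginals of a
single joint distribution: collapse theories are consistent with the absoluteness of
observed events. -/
theorem collapse_joint_distribution
    {S T S' T' : Type} [Countable S] [Countable T] [Countable S'] [Countable T']
    (p : PMF (S × T)) (f : S → PMF S') (g : T → PMF T') :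
    ∃ q : PMF (S × T × S' × T'),
      (∀ (s : S) (t : T),
        ∑' (s' : S') (t' : T'), q (s, t, s', t') = p (s, t)) ∧
      (∀ (s' : S') (t : T),
        ∑' (s : S) (t' : T'), q (s, t, s', t') = ∑' s : S, p (s, t) * f s s') ∧
      (∀ (s : S) (t' : T'),
        ∑' (t : T) (s' : S'), q (s, t, s', t') = ∑' t : T, p (s, t) * g t t') ∧
      (∀ (s' : S') (t' : T'),
        ∑' (s : S) (t : T), q (s, t, s', t')
          = ∑' (s : S) (t : T), p (s, t) * f s s' * g t t') := by
  refine ⟨p.collapseJoint f g, fun s t => ?_, fun s' t => ?_, fun s t' => ?_, fun s' t' => ?_⟩ <;>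
    simp only [PMF.collapseJoint_apply, ENNReal.tsum_mul_left, ENNReal.tsum_mul_right,
      PMF.tsum_coe, mul_one]
end

section
/- Let m, n ≥ 1 and let U ∈ Matrix (Fin m × Fin n) (Fin m × Fin n) ℂ be unitary. Define the partial trace over the first factor Tr_A : Matrix (Fin m × Fin n) (Fin m × Fin n) ℂ → Matrix (Fin n) (Fin n) ℂ by (Tr_A M)(j, j') = Σ_{i : Fin m} M (i,j) (i,j'), and the partial trace over the second factor Tr_B : Matrix (Fin m × Fin n) (Fin m × Fin n) ℂ → Matrix (Fin m) (Fin m) ℂ by (Tr_B M)(i, i') = Σ_{j : Fin n} M (i,j) (i',j). Suppose that for all positive semidefinite trace-one matrices τ, τ' ∈ Matrix (Fin m × Fin n) (Fin m × Fin n) ℂ: Tr_A τ = Tr_A τ' implies Tr_A (U * τ * Uᴴ) = Tr_A (U * τ' * Uᴴ), and Tr_B τ = Tr_B τ' implies Tr_B (U * τ * Uᴴ) = Tr_B (U * τ' * Uᴴ). Then there exist unitary matrices V ∈ Matrix (Fin m) (Fin m) ℂ and W ∈ Matrix (Fin n) (Fin n) ℂ such that U = V ⊗ₖ W. (A bipartite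 unitary with no causal influence from either side to the other is a tensor product of local unitaries — the two-party, no-ancilla instance of the dynamical separability of unitary quantum theory.) -/
open scoped BigOperators ComplexOrder Kronecker

/-- Partial trace over the first tensor factor. -/
noncomputable def ptraceA {m n : ℕ}
    (M : Matrix (Fin m × Fin n) (Fin m × Fin n) ℂ) : Matrix (Fin n) (Fin n) ℂ :=
  Matrix.of fun j j' => ∑ i : Fin m, M (i, j) (i, j')

/-- Partial trace over the second tensor factor. -/
noncomputable def ptraceB {m n : ℕ}
    (M : Matrix (Fin m × Fin n) (Fin m × Fin n) ℂ) : Matrix (Fin m) (Fin m) ℂ :=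
  Matrix.of fun i i' => ∑ j : Fin n, M (i, j) (i', j)

open Matrix

section PartialTrace

variable {m n : ℕ}

theorem ptraceB_add (M N : Matrix (Fin m × Fin n) (Fin m × Fin n) ℂ) :
    ptraceB (M + N) = ptraceB M + ptraceB N := by
  ext i i'
  simp [ptraceB, Finset.sum_add_distrib]

theorem ptraceB_smul (c : ℂ) (M : Matrix (Fin m × Fin n) (Fin m × Fin n) ℂ) :
    ptraceB (c • M) = c • ptraceB M := by
  ext i i'
  simp [ptraceB, Finset.mul_sum]

theorem ptraceB_conjTranspose (M : Matrix (Fin m × Fin n) (Fin m × Fin n) ℂ) :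
    ptraceB Mᴴ = (ptraceB M)ᴴ := by
  ext i i'
  simp [ptraceB]

theorem trace_ptraceB (M : Matrix (Fin m × Fin n) (Fin m × Fin n) ℂ) :
    (ptraceB M).trace = M.trace := by
  simp [ptraceB, trace, Fintype.sum_prod_type]

/-- If the reduced output state depends only on the reduced input state, then the
corresponding linear statement holds for sums of a matrix and its adjoint. -/
theorem ptraceB_conj_add_conjTranspose_eq_zero (hm : 1 ≤ m) (hn : 1 ≤ n)
    {U : Matrix (Fin m × Fin n) (Fin m × Fin n) ℂ}
    (hB : ∀ τ τ' : Matrix (Fin m × Fin n) (Fin m × Fin n) ℂ,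
      τ.PosSemidef → τ.trace = 1 → τ'.PosSemidef → τ'.trace = 1 →
      ptraceB τ = ptraceB τ' → ptraceB (U * τ * Uᴴ) = ptraceB (U * τ' * Uᴴ))
    {D : Matrix (Fin m × Fin n) (Fin m × Fin n) ℂ} (hD : ptraceB D = 0) :
    ptraceB (U * (D + Dᴴ) * Uᴴ) = 0 := by
  have hD' : ptraceB (D + Dᴴ) = 0 := by
    rw [ptraceB_add, ptraceB_conjTranspose, hD, conjTranspose_zero, add_zero]
  set P := Dᴴ * D + 1 with hP
  have hQ : P + (D + Dᴴ) = (D + 1)ᴴ * (D + 1) := by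
    simp only [hP, conjTranspose_add, conjTranspose_one]
    noncomm_ring
  have hPpos : P.PosSemidef := (posSemidef_conjTranspose_mul_self D).add PosSemidef.one
  have hQpos : (P + (D + Dᴴ)).PosSemidef := hQ ▸ posSemidef_conjTranspose_mul_self _
  have htr : P.trace ≠ 0 := by
    have h1 : 0 ≤ (Dᴴ * D).trace := (posSemidef_conjTranspose_mul_self D).trace_nonneg
    have h2 : (0 : ℂ) < (1 : Matrix (Fin m × Fin n) (Fin m × Fin n) ℂ).trace := by
      rw [trace_one]
      exact_mod_cast (by simp; omega : 0 < Fintype.card (Fin m × Fin n))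
    rw [hP, trace_add]
    exact (add_pos_of_nonneg_of_pos h1 h2).ne'
  have hinv : 0 ≤ P.trace⁻¹ := inv_nonneg.2 hPpos.trace_nonneg
  have htr' : (P + (D + Dᴴ)).trace = P.trace := by
    rw [trace_add, ← trace_ptraceB (D + Dᴴ), hD', trace_zero, add_zero]
  have key := hB (P.trace⁻¹ • P) (P.trace⁻¹ • (P + (D + Dᴴ)))
    (hPpos.smul hinv) (by rw [trace_smul, smul_eq_mul, inv_mul_cancel₀ htr])
    (hQpos.smul hinv) (by rw [trace_smul, htr', smul_eq_mul, inv_mul_cancel₀ htr])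
    (by rw [ptraceB_smul, ptraceB_smul, ptraceB_add P, hD', add_zero])
  simp only [mul_smul_comm, smul_mul_assoc, ptraceB_smul, mul_add, add_mul, ptraceB_add] at key
  have key := smul_right_injective _ (inv_ne_zero htr) key
  simpa only [mul_add, add_mul, ptraceB_add, left_eq_add] using key

theorem ptraceB_conj_eq_zero (hm : 1 ≤ m) (hn : 1 ≤ n)
    {U : Matrix (Fin m × Fin n) (Fin m × Fin n) ℂ}
    (hB : ∀ τ τ' : Matrix (Fin m × Fin n) (Fin m × Fin n) ℂ,
      τ.PosSemidef → τ.trace = 1 → τ'.PosSemidef → τ'.trace = 1 →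
      ptraceB τ = ptraceB τ' → ptraceB (U * τ * Uᴴ) = ptraceB (U * τ' * Uᴴ))
    {D : Matrix (Fin m × Fin n) (Fin m × Fin n) ℂ} (hD : ptraceB D = 0) :
    ptraceB (U * D * Uᴴ) = 0 := by
  have h1 := ptraceB_conj_add_conjTranspose_eq_zero hm hn hB hD
  have h2 := ptraceB_conj_add_conjTranspose_eq_zero hm hn hB
    (D := Complex.I • D) (by rw [ptraceB_smul, hD, smul_zero])
  have h3 : D = (1 / 2 : ℂ) • (D + Dᴴ)
      + (-Complex.I / 2) • (Complex.I • D + (Complex.I • D)ᴴ) := by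
    ext i j
    simp only [Matrix.add_apply, Matrix.smul_apply, conjTranspose_apply, smul_eq_mul, star_mul',
      Complex.star_def, Complex.conj_I]
    linear_combination (D i j / 2 - starRingEnd ℂ (D j i) / 2) * Complex.I_sq
  rw [h3, mul_add, add_mul, ptraceB_add, mul_smul_comm, mul_smul_comm, smul_mul_assoc,
    smul_mul_assoc, ptraceB_smul, ptraceB_smul, h1, h2, smul_zero, smul_zero, add_zero]

/-- The block of a bipartite matrix at the position `(a, c)` of the first factor. -/
def firstFactorBlock (U : Matrix (Fin m × Fin n) (Fin m × Fin n) ℂ) (a c : Fin m) :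
    Matrix (Fin n) (Fin n) ℂ :=
  Matrix.of fun b d => U (a, b) (c, d)

theorem ptraceB_conj_single (U : Matrix (Fin m × Fin n) (Fin m × Fin n) ℂ)
    (a a' c c' : Fin m) (d d' : Fin n) :
    ptraceB (U * single (c', d') (c, d) 1 * Uᴴ) a' a =
      ((firstFactorBlock U a c)ᴴ * firstFactorBlock U a' c') d d' := by
  simp only [ptraceB, firstFactorBlock, mul_apply, of_apply, conjTranspose_apply]
  refine Finset.sum_congr rfl fun b _ => ?_
  rw [Finset.sum_eq_single (c, d)]
  · rw [Finset.sum_eq_single (c', d')]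
    · simp [mul_comm]
    · intro x _ hx
      simp [hx.symm]
    · simp
  · intro x _ hx
    simp [hx.symm]
  · simp

theorem ptraceB_single (c c' : Fin m) (d d' : Fin n) (x : ℂ) :
    ptraceB (single (c', d') (c, d) x) = if d' = d then single c' c x else 0 := by
  ext i i'
  split_ifs with h
  · subst h
    simp only [ptraceB, of_apply, single_apply, Prod.mk.injEq]
    rw [Finset.sum_eq_single d'] <;> simp +contextual [eq_comm]
  · simp only [ptraceB, of_apply, single_apply, Prod.mk.injEq, Matrix.zero_apply]
    refine Finset.sum_eq_zero fun j _ => if_neg ?_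
    rintro ⟨⟨-, h1⟩, -, h2⟩
    exact h (h1.trans h2.symm)

theorem firstFactorBlock_conjTranspose_mul (hm : 1 ≤ m) (hn : 1 ≤ n)
    {U : Matrix (Fin m × Fin n) (Fin m × Fin n) ℂ}
    (hB : ∀ τ τ' : Matrix (Fin m × Fin n) (Fin m × Fin n) ℂ,
      τ.PosSemidef → τ.trace = 1 → τ'.PosSemidef → τ'.trace = 1 →
      ptraceB τ = ptraceB τ' → ptraceB (U * τ * Uᴴ) = ptraceB (U * τ' * Uᴴ))
    (a c a' c' : Fin m) :
    ∃ s : ℂ, (firstFactorBlock U a c)ᴴ * firstFactorBlock U a' c' = s • 1 := by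
  let e : Fin n := ⟨0, hn⟩
  refine ⟨((firstFactorBlock U a c)ᴴ * firstFactorBlock U a' c') e e, ?_⟩
  ext d d'
  rw [← ptraceB_conj_single, ← ptraceB_conj_single]
  by_cases h : d' = d
  · subst h
    have hD : ptraceB (single (c', d') (c, d') 1 + (-1 : ℂ) • single (c', e) (c, e) 1) = 0 := by
      rw [ptraceB_add, ptraceB_smul, ptraceB_single, ptraceB_single]
      simp
    have := ptraceB_conj_eq_zero hm hn hB hD
    rw [mul_add, add_mul, ptraceB_add, mul_smul_comm, smul_mul_assoc, ptraceB_smul,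
      neg_one_smul, ← sub_eq_add_neg, sub_eq_zero] at this
    simp [this]
  · rw [ptraceB_conj_eq_zero hm hn hB (by rw [ptraceB_single, if_neg h])]
    simp [one_apply_ne (Ne.symm h)]

end PartialTrace

/-- A bipartite unitary with no causal influence from either side to the other (in the
sense that each off-side reduced output state depends only on the corresponding reduced
input state) is a tensor product of local unitaries. -/
theorem no_influence_unitary_is_tensor_product
    {m n : ℕ} (hm : 1 ≤ m) (hn : 1 ≤ n)
    (U : Matrix (Fin m × Fin n) (Fin m × Fin n) ℂ)
    (hU₁ : U.conjTranspose * U = 1) (hU₂ : U * U.conjTranspose = 1)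
    (hA : ∀ τ τ' : Matrix (Fin m × Fin n) (Fin m × Fin n) ℂ,
      τ.PosSemidef → τ.trace = 1 → τ'.PosSemidef → τ'.trace = 1 →
      ptraceA τ = ptraceA τ' →
      ptraceA (U * τ * U.conjTranspose) = ptraceA (U * τ' * U.conjTranspose))
    (hB : ∀ τ τ' : Matrix (Fin m × Fin n) (Fin m × Fin n) ℂ,
      τ.PosSemidef → τ.trace = 1 → τ'.PosSemidef → τ'.trace = 1 →
      ptraceB τ = ptraceB τ' →
      ptraceB (U * τ * U.conjTranspose) = ptraceB (U * τ' * U.conjTranspose)) :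
    ∃ (V : Matrix (Fin m) (Fin m) ℂ) (W : Matrix (Fin n) (Fin n) ℂ),
      V.conjTranspose * V = 1 ∧ V * V.conjTranspose = 1 ∧
      W.conjTranspose * W = 1 ∧ W * W.conjTranspose = 1 ∧
      U = V ⊗ₖ W := by
  have hblock := firstFactorBlock_conjTranspose_mul hm hn hB
  obtain ⟨a, c, hK⟩ : ∃ a c, firstFactorBlock U a c ≠ 0 := by
    by_contra! h
    have hU : U = 0 := by
      ext ⟨i, j⟩ ⟨i', j'⟩
      exact congrFun₂ (h i i') j j'
    have := congrFun₂ hU₁ (⟨0, hm⟩, ⟨0, hn⟩) (⟨0, hm⟩, ⟨0, hn⟩)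
    simp [hU] at this
  set K := firstFactorBlock U a c with hKdef
  choose s hs using hblock a c
  rw [← hKdef] at hs
  have hs0 : 0 ≤ s a c := by
    have h := (posSemidef_conjTranspose_mul_self K).diag_nonneg (i := ⟨0, hn⟩)
    rw [hKdef, hs] at h
    simpa using h
  have hne : s a c ≠ 0 := by
    intro h
    apply hK
    rw [← conjTranspose_mul_self_eq_zero]
    rw [hKdef, hs, h, zero_smul]
  obtain ⟨r, hr⟩ : ∃ r : ℝ, s a c = r := ⟨(s a c).re, (Complex.eq_re_of_ofReal_le hs0)⟩
  have hrpos : 0 < r := by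
    rw [hr] at hs0 hne
    exact lt_of_le_of_ne (by exact_mod_cast hs0) fun h => hne (by simp [← h])
  have hq : ((√r : ℝ) : ℂ) * (√r : ℝ) = r := by
    exact_mod_cast Real.mul_self_sqrt hrpos.le
  have hq0 : ((√r : ℝ) : ℂ) ≠ 0 := by
    exact_mod_cast (Real.sqrt_pos.2 hrpos).ne'
  set q : ℂ := ((√r : ℝ) : ℂ) with hqdef
  have hqstar : star q = q := Complex.conj_ofReal _
  have hW : (q⁻¹ • K)ᴴ * (q⁻¹ • K) = 1 := by
    rw [conjTranspose_smul, smul_mul_smul_comm, star_inv₀, hqstar, hKdef, hs, hr, ← hq, smul_smul]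
    field_simp
    simp
  have hW' : (q⁻¹ • K) * (q⁻¹ • K)ᴴ = 1 := mul_eq_one_comm.1 hW
  have hU : U = (Matrix.of fun i i' => q⁻¹ * s i i') ⊗ₖ (q⁻¹ • K) := by
    ext ⟨i, j⟩ ⟨i', j'⟩
    have h : firstFactorBlock U i i' = (q⁻¹ * s i i') • (q⁻¹ • K) := by
      calc firstFactorBlock U i i'
          = (q⁻¹ • K) * (q⁻¹ • K)ᴴ * firstFactorBlock U i i' := by rw [hW', one_mul]
        _ = (q⁻¹ * s i i') • (q⁻¹ • K) := by
          rw [mul_assoc, conjTranspose_smul, smul_mul_assoc _ Kᴴ, hs, star_inv₀, hqstar, smul_smul,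
            mul_smul_comm, mul_one]
    exact congrFun₂ h j j'
  have hV : (Matrix.of fun i i' => q⁻¹ * s i i')ᴴ * (Matrix.of fun i i' => q⁻¹ * s i i') = 1 := by
    rw [hU, conjTranspose_kronecker, ← mul_kronecker_mul, hW] at hU₁
    ext i i'
    have h := congrFun₂ hU₁ (i, ⟨0, hn⟩) (i', ⟨0, hn⟩)
    simpa [kroneckerMap_apply, one_apply] using h
  exact ⟨_, _, hV, mul_eq_one_comm.1 hV, hW, hW', hU⟩
end
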